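/- If α ⪯ (0,0), then the multiplier algebra of D_α equals H^∞(𝕌²): M(D_α) = H^∞(𝕌²). -/

import Mathlib

open scoped BigOperators

/-- The open unit disc in ℂ. -/
def UnitDisc : Set ℂ := {z : ℂ | ‖z‖ < 1}

/-- The open unit bidisc in ℂ². -/
def UnitBidisc : Set (ℂ × ℂ) := {p : ℂ × ℂ | ‖p.1‖ < 1 ∧ ‖p.2‖ < 1}

/-- `a` is the double power series coefficient sequence of `f` on the bidisc. -/
def IsCoeff (f : ℂ × ℂ → ℂ) (a : ℕ → ℕ → ℂ) : Prop :=
  ∀ p ∈ UnitBidisc,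
    HasSum (fun kl : ℕ × ℕ => a kl.1 kl.2 * p.1 ^ kl.1 * p.2 ^ kl.2) (f p)

/-- Weighted squared-coefficient summand for the bidisc Dirichlet type space. -/
noncomputable def wt (a1 a2 : ℝ) (a : ℕ → ℕ → ℂ) (kl : ℕ × ℕ) : ℝ :=
  ‖a kl.1 kl.2‖ ^ 2 * ((kl.1 : ℝ) + 1) ^ a1 * ((kl.2 : ℝ) + 1) ^ a2

/-- Membership in the Dirichlet type space `D_{(a1,a2)}` on the bidisc. -/
def MemD (a1 a2 : ℝ) (f : ℂ × ℂ → ℂ) : Prop :=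
  ∃ a : ℕ → ℕ → ℂ, IsCoeff f a ∧ Summable (wt a1 a2 a)

/-- `b` is the power series coefficient sequence of `g` on the unit disc. -/
def IsCoeff1 (g : ℂ → ℂ) (b : ℕ → ℂ) : Prop :=
  ∀ z ∈ UnitDisc, HasSum (fun k : ℕ => b k * z ^ k) (g z)

/-- Weighted squared-coefficient summand for the one-variable Dirichlet type space. -/
noncomputable def wt1 (a : ℝ) (b : ℕ → ℂ) (k : ℕ) : ℝ :=
  ‖b k‖ ^ 2 * ((k : ℝ) + 1) ^ a

/-- Membership in the one-variable Dirichlet type space `D_a` on the unit disc. -/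
def MemD1 (a : ℝ) (g : ℂ → ℂ) : Prop :=
  ∃ b : ℕ → ℂ, IsCoeff1 g b ∧ Summable (wt1 a b)

/-- `φ` is a multiplier from `D_{(a1,a2)}` to `D_{(b1,b2)}` on the bidisc. -/
def MemM (a1 a2 b1 b2 : ℝ) (φ : ℂ × ℂ → ℂ) : Prop :=
  ∀ f : ℂ × ℂ → ℂ, MemD a1 a2 f → MemD b1 b2 (fun p => φ p * f p)

/-- `φ` is a multiplier from `D_a` to `D_b` on the unit disc. -/
def MemM1 (a b : ℝ) (φ : ℂ → ℂ) : Prop :=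
  ∀ g : ℂ → ℂ, MemD1 a g → MemD1 b (fun z => φ z * g z)

/-- The norm of the evaluation functional at `(z,w)` on `D_{(g1,g2)}`. -/
noncomputable def evalNorm (g1 g2 : ℝ) (z w : ℂ) : ℝ :=
  Real.sqrt (∑' kl : ℕ × ℕ,
    ‖z‖ ^ (2 * kl.1) * ‖w‖ ^ (2 * kl.2) *
      ((kl.1 : ℝ) + 1) ^ (-g1) * ((kl.2 : ℝ) + 1) ^ (-g2))

open Filter Topology Metric

/-- A bounded holomorphic function on the unit disc has bounded Taylor coefficients. -/
lemma exists_coeff_of_bounded {h : ℂ → ℂ} {M : ℝ} (hd : DifferentiableOn ℂ h (ball 0 1))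
    (hM : ∀ z ∈ ball (0 : ℂ) 1, ‖h z‖ ≤ M) :
    ∃ c : ℕ → ℂ, (∀ k, ‖c k‖ ≤ M) ∧
      ∀ z ∈ ball (0 : ℂ) 1, HasSum (fun k => c k * z ^ k) (h z) := by
  refine ⟨fun k => ((k.factorial : ℂ))⁻¹ * iteratedDeriv k h 0, fun k => ?_, fun z hz => ?_⟩
  · have hbound : ∀ R ∈ Set.Ioo (0 : ℝ) 1,
        ‖((k.factorial : ℂ))⁻¹ * iteratedDeriv k h 0‖ * R ^ k ≤ M := by
      intro R hR
      have hsub : closedBall (0 : ℂ) R ⊆ ball 0 1 := closedBall_subset_ball hR.2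
      have h1 := Complex.norm_iteratedDeriv_le_of_forall_mem_sphere_norm_le (f := h) (c := 0)
        (C := M) k hR.1 ((hd.mono (by
          rw [closure_ball _ hR.1.ne']; exact hsub)).diffContOnCl)
        (fun z hz => hM z (hsub (sphere_subset_closedBall hz)))
      have hRk : 0 < R ^ k := pow_pos hR.1 k
      have hk : (0 : ℝ) < k.factorial := by exact_mod_cast k.factorial_pos
      rw [le_div_iff₀ hRk] at h1
      rw [norm_mul, norm_inv, Complex.norm_natCast, mul_assoc, inv_mul_le_iff₀ hk]
      exact h1
    have hlim : Tendsto (fun R : ℝ => ‖((k.factorial : ℂ))⁻¹ * iteratedDeriv k h 0‖ * R ^ k)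
        (𝓝[<] 1) (𝓝 (‖((k.factorial : ℂ))⁻¹ * iteratedDeriv k h 0‖ * 1 ^ k)) :=
      ((continuous_const.mul (continuous_id.pow k)).tendsto 1).mono_left nhdsWithin_le_nhds
    rw [one_pow, mul_one] at hlim
    refine le_of_tendsto hlim ?_
    filter_upwards [Ioo_mem_nhdsLT (zero_lt_one' ℝ)] with R hR using hbound R hR
  · convert! Complex.hasSum_taylorSeries_on_ball hd hz using 2 with k
    simp only [sub_zero, smul_eq_mul]
    ring

/-- If a bounded family of power series `∑ l, c l z * w ^ l` is holomorphic in `z` for each `w`,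
then each coefficient is holomorphic in `z`. -/
lemma differentiableOn_coeff {φ : ℂ → ℂ → ℂ} {c : ℕ → ℂ → ℂ} {M : ℝ} {U : Set ℂ} (hU : IsOpen U)
    (hφ : ∀ w ∈ ball (0 : ℂ) 1, DifferentiableOn ℂ (fun z => φ z w) U)
    (hc : ∀ l, ∀ z ∈ U, ‖c l z‖ ≤ M)
    (hsum : ∀ z ∈ U, ∀ w ∈ ball (0 : ℂ) 1, HasSum (fun l => c l z * w ^ l) (φ z w)) (l : ℕ) :
    DifferentiableOn ℂ (c l) U := by
  rcases U.eq_empty_or_nonempty with rfl | ⟨z₀, hz₀⟩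
  · exact differentiableOn_empty
  have hM0 : 0 ≤ M := (norm_nonneg _).trans (hc 0 z₀ hz₀)
  induction l using Nat.strong_induction_on with
  | _ l ih =>
  let x : ℕ → ℝ := fun n => 1 / ((n : ℝ) + 1) / 2
  have hx0 : ∀ n, 0 < x n := fun n => by positivity
  have hx2 : ∀ n, x n ≤ 1 / 2 := fun n => by
    have : 1 / ((n : ℝ) + 1) ≤ 1 := by
      rw [div_le_one (by positivity)]; linarith [(Nat.cast_nonneg n : (0 : ℝ) ≤ n)]
    simp only [x]; linarith
  have hnorm : ∀ n, ‖(x n : ℂ)‖ = x n := fun n => by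
    rw [Complex.norm_real, Real.norm_of_nonneg (hx0 n).le]
  have hball : ∀ n, (x n : ℂ) ∈ ball (0 : ℂ) 1 := fun n => by
    rw [mem_ball_zero_iff, hnorm]; linarith [hx2 n]
  have hxlim : Tendsto (fun n => 2 * M * x n) atTop (𝓝 0) := by
    have := ((tendsto_one_div_add_atTop_nhds_zero_nat (𝕜 := ℝ)).div_const 2).const_mul (2 * M)
    simpa [x] using this
  let F : ℕ → ℂ → ℂ := fun n z =>
    (φ z (x n) - ∑ j ∈ Finset.range l, c j z * (x n : ℂ) ^ j) / (x n : ℂ) ^ l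
  have hest : ∀ n, ∀ z ∈ U, ‖F n z - c l z‖ ≤ 2 * M * x n := by
    intro n z hz
    have hw : (x n : ℂ) ≠ 0 := by exact_mod_cast (hx0 n).ne'
    have hs := (hasSum_nat_add_iff' (l + 1)).2 (hsum z hz _ (hball n))
    have hs2 : HasSum (fun j => c (j + (l + 1)) z * (x n : ℂ) ^ (j + 1)) (F n z - c l z) := by
      convert! hs.div_const ((x n : ℂ) ^ l) using 1
      · ext j
        rw [eq_div_iff (pow_ne_zero _ hw)]
        ring
      · simp only [F, Finset.sum_range_succ]
        field_simp
        ring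
    have hg : HasSum (fun j => M * x n * (x n) ^ j) (M * x n * (1 - x n)⁻¹) :=
      (hasSum_geometric_of_lt_one (hx0 n).le (by linarith [hx2 n])).mul_left _
    have := hs2.norm_le_of_bounded hg (fun j => by
      rw [norm_mul, norm_pow, hnorm, mul_assoc, ← pow_succ']
      exact mul_le_mul_of_nonneg_right (hc _ _ hz) (pow_nonneg (hx0 n).le _))
    refine this.trans ?_
    have h2 : (1 - x n)⁻¹ ≤ 2 := by
      rw [inv_le_comm₀ (by linarith [hx2 n]) two_pos]; linarith [hx2 n]
    nlinarith [mul_nonneg hM0 (hx0 n).le]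
  have hunif : TendstoUniformlyOn F (c l) atTop U := by
    rw [Metric.tendstoUniformlyOn_iff]
    intro ε hε
    filter_upwards [hxlim.eventually_lt_const hε] with n hn z hz
    rw [dist_comm, dist_eq_norm]
    exact (hest n z hz).trans_lt hn
  refine hunif.tendstoLocallyUniformlyOn.differentiableOn (Eventually.of_forall fun n => ?_) hU
  refine DifferentiableOn.div_const (DifferentiableOn.sub (hφ _ (hball n)) ?_) _
  exact DifferentiableOn.fun_sum fun j hj => (ih j (Finset.mem_range.1 hj)).mul_const _

/-- A bounded holomorphic function on the bidisc has a double power series expansion. -/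
lemma exists_isCoeff {φ : ℂ × ℂ → ℂ} {M : ℝ} (hd : DifferentiableOn ℂ φ UnitBidisc)
    (hM : ∀ p ∈ UnitBidisc, ‖φ p‖ ≤ M) : ∃ b, IsCoeff φ b := by
  have hmem : ∀ {z w : ℂ}, z ∈ ball (0 : ℂ) 1 → w ∈ ball (0 : ℂ) 1 → (z, w) ∈ UnitBidisc :=
    fun hz hw => ⟨mem_ball_zero_iff.1 hz, mem_ball_zero_iff.1 hw⟩
  have h1 : ∀ z : ℂ, ∃ c : ℕ → ℂ, z ∈ ball (0 : ℂ) 1 → (∀ l, ‖c l‖ ≤ M) ∧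
      ∀ w ∈ ball (0 : ℂ) 1, HasSum (fun l => c l * w ^ l) (φ (z, w)) := by
    intro z
    by_cases hz : z ∈ ball (0 : ℂ) 1
    · obtain ⟨c, hc⟩ := exists_coeff_of_bounded (h := fun w => φ (z, w)) (M := M)
        (hd.comp (by fun_prop) fun w hw => hmem hz hw) fun w hw => hM _ (hmem hz hw)
      exact ⟨c, fun _ => hc⟩
    · exact ⟨0, fun h => absurd h hz⟩
  choose c hc using h1
  have hcd : ∀ l, DifferentiableOn ℂ (fun z => c z l) (ball 0 1) :=
    differentiableOn_coeff (φ := fun z w => φ (z, w)) (c := fun l z => c z l) (M := M) isOpen_ball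
      (fun w hw => hd.comp (by fun_prop) fun z hz => hmem hz hw) (fun l z hz => (hc z hz).1 l)
      fun z hz => (hc z hz).2
  choose b hb hbs using fun l => exists_coeff_of_bounded (hcd l) fun z hz => (hc z hz).1 l
  refine ⟨fun k l => b l k, fun p hp => ?_⟩
  have hp1 : p.1 ∈ ball (0 : ℂ) 1 := mem_ball_zero_iff.2 hp.1
  have hp2 : p.2 ∈ ball (0 : ℂ) 1 := mem_ball_zero_iff.2 hp.2
  have hsm : Summable fun kl : ℕ × ℕ => b kl.2 kl.1 * p.1 ^ kl.1 * p.2 ^ kl.2 := by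
    refine .of_norm_bounded (((summable_geometric_of_lt_one (norm_nonneg _) hp.1).mul_of_nonneg
      (summable_geometric_of_lt_one (norm_nonneg _) hp.2) (fun _ => by positivity)
      fun _ => by positivity).mul_left M) fun kl => ?_
    rw [norm_mul, norm_mul, norm_pow, norm_pow, mul_assoc]
    exact mul_le_mul_of_nonneg_right (hb _ _) (by positivity)
  have hswap := hsm.prod_symm.hasSum.prod_fiberwise fun l => (hbs l p.1 hp1).mul_right (p.2 ^ l)
  have heq : ∑' kl : ℕ × ℕ, b kl.2 kl.1 * p.1 ^ kl.1 * p.2 ^ kl.2 = φ p := by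
    rw [← (Equiv.prodComm ℕ ℕ).tsum_eq]
    exact hswap.unique ((hc p.1 hp1).2 p.2 hp2)
  exact heq ▸ hsm.hasSum

/-- Pairs of pairs of natural numbers with a given sum. -/
local instance instHasAntidiagonalNatProd : Finset.HasAntidiagonal (ℕ × ℕ) where
  antidiagonal n := (Finset.Iic n ×ˢ Finset.Iic n).filter fun q => q.1 + q.2 = n
  mem_antidiagonal := by
    intro n q
    simp only [Finset.mem_filter, Finset.mem_product, Finset.mem_Iic, and_iff_right_iff_imp]
    rintro rfl
    exact ⟨le_self_add, le_add_self⟩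

/-- The coefficients of a product of double power series. -/
def coeffMul (b a : ℕ → ℕ → ℂ) (k l : ℕ) : ℂ :=
  ∑ q ∈ Finset.HasAntidiagonal.antidiagonal (k, l), b q.1.1 q.1.2 * a q.2.1 q.2.2

lemma IsCoeff.mul {φ f : ℂ × ℂ → ℂ} {b a : ℕ → ℕ → ℂ} (hφ : IsCoeff φ b) (hf : IsCoeff f a) :
    IsCoeff (fun p => φ p * f p) (coeffMul b a) := by
  intro p hp
  let F : ℕ × ℕ → ℂ := fun n => b n.1 n.2 * p.1 ^ n.1 * p.2 ^ n.2
  let G : ℕ × ℕ → ℂ := fun n => a n.1 n.2 * p.1 ^ n.1 * p.2 ^ n.2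
  have h1 : HasSum F (φ p) := hφ p hp
  have h2 : HasSum G (f p) := hf p hp
  have h3 : Summable fun x : (ℕ × ℕ) × (ℕ × ℕ) => F x.1 * G x.2 :=
    summable_mul_of_summable_norm h1.summable.norm h2.summable.norm
  have h4 := (summable_sum_mul_antidiagonal_of_summable_mul h3).hasSum
  rw [← h1.summable.tsum_mul_tsum_eq_tsum_sum_antidiagonal h2.summable h3, h1.tsum_eq,
    h2.tsum_eq] at h4
  have h5 : ∀ n : ℕ × ℕ, coeffMul b a n.1 n.2 * p.1 ^ n.1 * p.2 ^ n.2 =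
      ∑ q ∈ Finset.HasAntidiagonal.antidiagonal n, F q.1 * G q.2 := by
    intro n
    rw [coeffMul, Finset.sum_mul, Finset.sum_mul]
    refine Finset.sum_congr rfl fun q hq => ?_
    have hq' : q.1 + q.2 = n := Finset.HasAntidiagonal.mem_antidiagonal.1 hq
    simp only [F, G]
    rw [← hq', Prod.fst_add, Prod.snd_add, pow_add, pow_add]
    ring
  simp only [h5]
  exact h4

/-- The coefficients of a product in a lower rectangle depend only on those of the factor there. -/
lemma coeffMul_congr {b a a' : ℕ → ℕ → ℂ} {k l : ℕ}
    (h : ∀ i ≤ k, ∀ j ≤ l, a i j = a' i j) : coeffMul b a k l = coeffMul b a' k l := by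
  refine Finset.sum_congr rfl fun q hq => ?_
  have hq' : q.1 + q.2 = (k, l) := Finset.HasAntidiagonal.mem_antidiagonal.1 hq
  have h1 : q.1.1 + q.2.1 = k := congrArg Prod.fst hq'
  have h2 : q.1.2 + q.2.2 = l := congrArg Prod.snd hq'
  rw [h _ (by omega) _ (by omega)]

/-- Monomials on the two-dimensional torus. -/
noncomputable def torusMonomial (n : ℕ × ℕ) : C(UnitAddCircle × UnitAddCircle, ℂ) where
  toFun x := fourier (n.1 : ℤ) x.1 * fourier (n.2 : ℤ) x.2

/-- Normalised Haar measure on the two-dimensional torus. -/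
noncomputable abbrev torusMeasure : MeasureTheory.Measure (UnitAddCircle × UnitAddCircle) :=
  AddCircle.haarAddCircle.prod AddCircle.haarAddCircle

/-- The monomials on the torus as elements of `L²`. -/
noncomputable abbrev torusMonomialLp (n : ℕ × ℕ) : MeasureTheory.Lp ℂ 2 torusMeasure :=
  ContinuousMap.toLp 2 torusMeasure ℂ (torusMonomial n)

lemma integral_fourier_mul_conj (i j : ℤ) :
    ∫ x : UnitAddCircle, fourier j x * (starRingEnd ℂ) (fourier i x) ∂AddCircle.haarAddCircle =
      if i = j then 1 else 0 := by
  have h := orthonormal_iff_ite.1 (orthonormal_fourier (T := 1)) i j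
  rwa [fourierLp, fourierLp, MeasureTheory.ContinuousMap.inner_toLp] at h

lemma orthonormal_torusMonomialLp : Orthonormal ℂ torusMonomialLp := by
  rw [orthonormal_iff_ite]
  intro m n
  rw [MeasureTheory.ContinuousMap.inner_toLp]
  have : ∀ x : UnitAddCircle × UnitAddCircle,
      torusMonomial n x * (starRingEnd ℂ) (torusMonomial m x) =
      (fourier (n.1 : ℤ) x.1 * (starRingEnd ℂ) (fourier (m.1 : ℤ) x.1)) *
        (fourier (n.2 : ℤ) x.2 * (starRingEnd ℂ) (fourier (m.2 : ℤ) x.2)) := by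
    intro x
    simp only [torusMonomial, ContinuousMap.coe_mk, map_mul]
    ring
  simp_rw [this]
  rw [MeasureTheory.integral_prod_mul
    (fun x : UnitAddCircle => fourier (n.1 : ℤ) x * (starRingEnd ℂ) (fourier (m.1 : ℤ) x))
    (fun x : UnitAddCircle => fourier (n.2 : ℤ) x * (starRingEnd ℂ) (fourier (m.2 : ℤ) x)),
    integral_fourier_mul_conj, integral_fourier_mul_conj]
  simp only [Nat.cast_inj, Prod.ext_iff]
  split_ifs <;> simp_all

lemma norm_torusMonomial_le (n : ℕ × ℕ) : ‖torusMonomial n‖ ≤ 1 := by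
  refine (ContinuousMap.norm_le _ zero_le_one).2 fun x => ?_
  simp only [torusMonomial, ContinuousMap.coe_mk, fourier_apply, norm_mul, Circle.norm_coe, mul_one,
    le_refl]

/-- The point of the torus of radius `r` with given angles. -/
noncomputable def torusPoint (r : ℝ) (x : UnitAddCircle × UnitAddCircle) : ℂ × ℂ :=
  (r * fourier 1 x.1, r * fourier 1 x.2)

lemma torusPoint_mem {r : ℝ} (hr0 : 0 ≤ r) (hr1 : r < 1) (x : UnitAddCircle × UnitAddCircle) :
    torusPoint r x ∈ UnitBidisc := by
  constructor <;>
    simpa only [torusPoint, fourier_apply, norm_mul, Circle.norm_coe, mul_one, Complex.norm_real,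
      Real.norm_of_nonneg hr0] using hr1

lemma torusPoint_pow (r : ℝ) (x : UnitAddCircle × UnitAddCircle) (n : ℕ × ℕ) :
    (torusPoint r x).1 ^ n.1 * (torusPoint r x).2 ^ n.2 =
      (r : ℂ) ^ (n.1 + n.2) * torusMonomial n x := by
  have h : ∀ (k : ℕ) (y : UnitAddCircle), (fourier 1 y) ^ k = fourier (k : ℤ) y := by
    intro k y
    simp [fourier_apply, AddCircle.toCircle_nsmul]
  simp only [torusPoint, torusMonomial, ContinuousMap.coe_mk, mul_pow, h, pow_add]
  ring

lemma IsCoeff.summable_norm {f : ℂ × ℂ → ℂ} {a : ℕ → ℕ → ℂ} (hf : IsCoeff f a) {r : ℝ}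
    (hr0 : 0 ≤ r) (hr1 : r < 1) :
    Summable fun n : ℕ × ℕ => ‖a n.1 n.2‖ * r ^ (n.1 + n.2) := by
  have hr : ‖(r : ℂ)‖ < 1 := by rwa [Complex.norm_real, Real.norm_of_nonneg hr0]
  have h := (hf (r, r) ⟨hr, hr⟩).summable.norm
  refine h.congr fun n => ?_
  rw [norm_mul, norm_mul, norm_pow, norm_pow, Complex.norm_real, Real.norm_of_nonneg hr0, mul_assoc,
    pow_add]

/-- A double power series restricted to a torus is its Fourier series. -/
lemma IsCoeff.exists_hasSum_torus {f : ℂ × ℂ → ℂ} {a : ℕ → ℕ → ℂ} (hf : IsCoeff f a) {r : ℝ}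
    (hr0 : 0 ≤ r) (hr1 : r < 1) :
    ∃ G : C(UnitAddCircle × UnitAddCircle, ℂ), (∀ x, G x = f (torusPoint r x)) ∧
      HasSum (fun n : ℕ × ℕ => (a n.1 n.2 * (r : ℂ) ^ (n.1 + n.2)) • torusMonomialLp n)
        (ContinuousMap.toLp 2 torusMeasure ℂ G) := by
  have hs : Summable fun n : ℕ × ℕ => (a n.1 n.2 * (r : ℂ) ^ (n.1 + n.2)) • torusMonomial n := by
    refine .of_norm_bounded (hf.summable_norm hr0 hr1) fun n => ?_
    rw [norm_smul, norm_mul, norm_pow, Complex.norm_real, Real.norm_of_nonneg hr0]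
    exact mul_le_of_le_one_right (by positivity) (norm_torusMonomial_le n)
  refine ⟨_, fun x => ?_, by simpa using hs.hasSum.mapL (ContinuousMap.toLp 2 torusMeasure ℂ)⟩
  have h1 := hs.hasSum.mapL (ContinuousMap.evalCLM ℂ x)
  refine h1.unique ?_
  convert! hf _ (torusPoint_mem hr0 hr1 x) using 2 with n
  rw [mul_assoc _ (_ ^ _) (_ ^ _), torusPoint_pow]
  simp [mul_assoc]

lemma Orthonormal.inner_hasSum {ι E : Type*} [NormedAddCommGroup E] [InnerProductSpace ℂ E]
    {v : ι → E} (hv : Orthonormal ℂ v) {c : ι → ℂ} {x : E} (h : HasSum (fun i => c i • v i) x)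
    (i : ι) : inner ℂ (v i) x = c i := by
  classical
  have h1 := h.mapL (innerSL ℂ (v i))
  simp only [innerSL_apply_apply, inner_smul_right, orthonormal_iff_ite.1 hv, mul_ite, mul_one,
    mul_zero] at h1
  refine h1.unique ?_
  convert! hasSum_ite_eq i (c i) using 2 with j
  grind

/-- Multiplication by a function bounded by `M` has norm at most `M` on coefficients. -/
lemma sum_norm_sq_coeffMul_le_of_finite {φ : ℂ × ℂ → ℂ} {b a : ℕ → ℕ → ℂ} {M : ℝ}
    (hφ : IsCoeff φ b) (hM : ∀ p ∈ UnitBidisc, ‖φ p‖ ≤ M) (s : Finset (ℕ × ℕ))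
    (ha : ∀ n : ℕ × ℕ, n ∉ s → a n.1 n.2 = 0) :
    ∑ n ∈ s, ‖coeffMul b a n.1 n.2‖ ^ 2 ≤ M ^ 2 * ∑ n ∈ s, ‖a n.1 n.2‖ ^ 2 := by
  let f : ℂ × ℂ → ℂ := fun p => ∑ n ∈ s, a n.1 n.2 * p.1 ^ n.1 * p.2 ^ n.2
  have hf : IsCoeff f a := fun p _ => hasSum_sum_of_ne_finset_zero fun n hn => by simp [ha n hn]
  have hbound : ∀ r ∈ Set.Ioo (0 : ℝ) 1,
      ∑ n ∈ s, (‖coeffMul b a n.1 n.2‖ * r ^ (n.1 + n.2)) ^ 2 ≤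
        M ^ 2 * ∑ n ∈ s, (‖a n.1 n.2‖ * r ^ (n.1 + n.2)) ^ 2 := by
    intro r hr
    have hnorm : ∀ (c : ℕ → ℕ → ℂ) (n : ℕ × ℕ), ‖c n.1 n.2 * (r : ℂ) ^ (n.1 + n.2)‖ =
        ‖c n.1 n.2‖ * r ^ (n.1 + n.2) := fun c n => by
      rw [norm_mul, norm_pow, Complex.norm_real, Real.norm_of_nonneg hr.1.le]
    obtain ⟨G, hG, hGs⟩ := (hφ.mul hf).exists_hasSum_torus hr.1.le hr.2
    obtain ⟨P, hP, hPs⟩ := hf.exists_hasSum_torus hr.1.le hr.2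
    have h1 := orthonormal_torusMonomialLp.sum_inner_products_le (s := s)
      (ContinuousMap.toLp 2 torusMeasure ℂ G)
    simp only [orthonormal_torusMonomialLp.inner_hasSum hGs, hnorm] at h1
    have h2 : ‖ContinuousMap.toLp 2 torusMeasure ℂ G‖ ≤
        M * ‖ContinuousMap.toLp 2 torusMeasure ℂ P‖ := by
      refine MeasureTheory.Lp.norm_le_mul_norm_of_ae_le_mul ?_
      filter_upwards [ContinuousMap.coeFn_toLp (p := 2) (𝕜 := ℂ) torusMeasure G,
        ContinuousMap.coeFn_toLp (p := 2) (𝕜 := ℂ) torusMeasure P] with x hx hx'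
      rw [hx, hx', hG, hP, norm_mul]
      exact mul_le_mul_of_nonneg_right (hM _ (torusPoint_mem hr.1.le hr.2 x)) (norm_nonneg _)
    have h3 : ‖ContinuousMap.toLp 2 torusMeasure ℂ P‖ ^ 2 =
        ∑ n ∈ s, (‖a n.1 n.2‖ * r ^ (n.1 + n.2)) ^ 2 := by
      have h4 : ContinuousMap.toLp 2 torusMeasure ℂ P =
          ∑ n ∈ s, (a n.1 n.2 * (r : ℂ) ^ (n.1 + n.2)) • torusMonomialLp n :=
        hPs.unique (hasSum_sum_of_ne_finset_zero fun n hn => by simp [ha n hn])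
      have h5 : (‖ContinuousMap.toLp 2 torusMeasure ℂ P‖ ^ 2 : ℂ) =
          ∑ n ∈ s, ((‖a n.1 n.2‖ * r ^ (n.1 + n.2) : ℝ) : ℂ) ^ 2 := by
        refine (inner_self_eq_norm_sq_to_K (𝕜 := ℂ)
          (ContinuousMap.toLp 2 torusMeasure ℂ P)).symm.trans ?_
        rw [h4, orthonormal_torusMonomialLp.inner_sum]
        refine Finset.sum_congr rfl fun n _ => ?_
        rw [Complex.conj_mul', hnorm]
      exact_mod_cast h5
    calc _ ≤ _ := h1
      _ ≤ (M * ‖ContinuousMap.toLp 2 torusMeasure ℂ P‖) ^ 2 := by gcongr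
      _ = _ := by rw [mul_pow, h3]
  have hlim : ∀ c : ℕ → ℕ → ℂ, Tendsto
      (fun r : ℝ => ∑ n ∈ s, (‖c n.1 n.2‖ * r ^ (n.1 + n.2)) ^ 2) (𝓝[<] 1)
      (𝓝 (∑ n ∈ s, ‖c n.1 n.2‖ ^ 2)) := by
    intro c
    have : Continuous fun r : ℝ => ∑ n ∈ s, (‖c n.1 n.2‖ * r ^ (n.1 + n.2)) ^ 2 := by fun_prop
    simpa using (this.tendsto 1).mono_left nhdsWithin_le_nhds
  refine le_of_tendsto_of_tendsto (hlim _) ((hlim _).const_mul _) ?_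
  filter_upwards [Ioo_mem_nhdsLT (zero_lt_one' ℝ)] with r hr using hbound r hr

lemma sum_norm_sq_coeffMul_le {φ : ℂ × ℂ → ℂ} {b a : ℕ → ℕ → ℂ} {M : ℝ}
    (hφ : IsCoeff φ b) (hM : ∀ p ∈ UnitBidisc, ‖φ p‖ ≤ M) (K L : ℕ) :
    ∑ k ∈ Finset.range K, ∑ l ∈ Finset.range L, ‖coeffMul b a k l‖ ^ 2 ≤
      M ^ 2 * ∑ k ∈ Finset.range K, ∑ l ∈ Finset.range L, ‖a k l‖ ^ 2 := by
  let a' : ℕ → ℕ → ℂ := fun k l => if k < K ∧ l < L then a k l else 0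
  have h := sum_norm_sq_coeffMul_le_of_finite (a := a') hφ hM
    (Finset.range K ×ˢ Finset.range L) fun n hn => by
      simp only [Finset.mem_product, Finset.mem_range] at hn
      simp only [a', if_neg hn]
  rw [Finset.sum_product, Finset.sum_product] at h
  convert! h using 1
  · refine Finset.sum_congr rfl fun k hk => Finset.sum_congr rfl fun l hl => ?_
    rw [Finset.mem_range] at hk hl
    rw [coeffMul_congr fun i hi j hj => ?_]
    simp only [a', if_pos (show i < K ∧ j < L by omega)]
  · congr 1
    refine Finset.sum_congr rfl fun k hk => Finset.sum_congr rfl fun l hl => ?_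
    rw [Finset.mem_range] at hk hl
    simp only [a', if_pos (And.intro hk hl)]

/-- Domination of partial sums is preserved by nonincreasing nonnegative weights. -/
lemma sum_mul_le_sum_mul_of_antitone {u x y : ℕ → ℝ} (hu : Antitone u) (hu0 : ∀ k, 0 ≤ u k)
    (h : ∀ N, ∑ k ∈ Finset.range N, x k ≤ ∑ k ∈ Finset.range N, y k) (N : ℕ) :
    ∑ k ∈ Finset.range N, u k * x k ≤ ∑ k ∈ Finset.range N, u k * y k := by
  have key : ∀ N, u N * (∑ k ∈ Finset.range N, y k - ∑ k ∈ Finset.range N, x k) ≤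
      ∑ k ∈ Finset.range N, u k * y k - ∑ k ∈ Finset.range N, u k * x k := by
    intro N
    induction N with
    | zero => simp
    | succ N ih =>
      have h1 := mul_le_mul_of_nonneg_right (hu N.le_succ) (sub_nonneg.2 (h (N + 1)))
      simp only [Nat.succ_eq_add_one, Finset.sum_range_succ] at h1 ih ⊢
      linarith
  have h1 := mul_nonneg (hu0 N) (sub_nonneg.2 (h N))
  linarith [key N]

lemma antitone_add_one_rpow {s : ℝ} (hs : s ≤ 0) : Antitone fun k : ℕ => ((k : ℝ) + 1) ^ s := by
  intro i j hij
  have : (i : ℝ) ≤ j := by exact_mod_cast hij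
  exact Real.rpow_le_rpow_of_nonpos (by positivity) (by linarith) hs

lemma wt_nonneg (a1 a2 : ℝ) (a : ℕ → ℕ → ℂ) (n : ℕ × ℕ) : 0 ≤ wt a1 a2 a n := by
  unfold wt
  positivity

lemma summable_wt_coeffMul {φ : ℂ × ℂ → ℂ} {b a : ℕ → ℕ → ℂ} {M a1 a2 : ℝ} (h1 : a1 ≤ 0)
    (h2 : a2 ≤ 0) (hφ : IsCoeff φ b) (hM : ∀ p ∈ UnitBidisc, ‖φ p‖ ≤ M)
    (ha : Summable (wt a1 a2 a)) : Summable (wt a1 a2 (coeffMul b a)) := by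
  let u : ℕ → ℝ := fun k => ((k : ℝ) + 1) ^ a1
  let v : ℕ → ℝ := fun l => ((l : ℝ) + 1) ^ a2
  have hrect : ∀ K L, ∑ k ∈ Finset.range K, u k *
      ∑ l ∈ Finset.range L, v l * ‖coeffMul b a k l‖ ^ 2 ≤
      ∑ k ∈ Finset.range K, u k * ∑ l ∈ Finset.range L, v l * (M ^ 2 * ‖a k l‖ ^ 2) := by
    intro K L
    refine sum_mul_le_sum_mul_of_antitone (antitone_add_one_rpow h1) (fun k => by positivity)
      (fun K => ?_) K
    rw [Finset.sum_comm, Finset.sum_comm (s := Finset.range K)]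
    simp only [← Finset.mul_sum]
    refine sum_mul_le_sum_mul_of_antitone (antitone_add_one_rpow h2) (fun k => by positivity)
      (fun L => ?_) L
    rw [Finset.sum_comm, ← Finset.mul_sum, Finset.sum_comm (s := Finset.range L)]
    exact sum_norm_sq_coeffMul_le hφ hM K L
  refine summable_of_sum_le (c := M ^ 2 * ∑' n, wt a1 a2 a n) (wt_nonneg _ _ _) fun s => ?_
  obtain ⟨N, hN⟩ : ∃ N, s ⊆ Finset.range N ×ˢ Finset.range N := by
    refine ⟨s.sup (fun n => n.1 + n.2) + 1, fun n hn => ?_⟩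
    have := Finset.le_sup (f := fun n : ℕ × ℕ => n.1 + n.2) hn
    simp only [Finset.mem_product, Finset.mem_range] at this ⊢
    omega
  calc ∑ n ∈ s, wt a1 a2 (coeffMul b a) n
      ≤ ∑ n ∈ Finset.range N ×ˢ Finset.range N, wt a1 a2 (coeffMul b a) n :=
        Finset.sum_le_sum_of_subset_of_nonneg hN fun n _ _ => wt_nonneg _ _ _ n
    _ = ∑ k ∈ Finset.range N, u k * ∑ l ∈ Finset.range N, v l * ‖coeffMul b a k l‖ ^ 2 := by
        simp only [Finset.sum_product, Finset.mul_sum, wt, u, v]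
        exact Finset.sum_congr rfl fun k _ => Finset.sum_congr rfl fun l _ => by ring
    _ ≤ _ := hrect N N
    _ = M ^ 2 * ∑ n ∈ Finset.range N ×ˢ Finset.range N, wt a1 a2 a n := by
        simp only [Finset.sum_product, Finset.mul_sum, wt, u, v]
        exact Finset.sum_congr rfl fun k _ => Finset.sum_congr rfl fun l _ => by ring
    _ ≤ M ^ 2 * ∑' n, wt a1 a2 a n := by
        gcongr
        exact ha.sum_le_tsum _ fun n _ => wt_nonneg _ _ _ n

/-- Bounded holomorphic functions are multipliers. -/
lemma memM_of_bounded {φ : ℂ × ℂ → ℂ} {M a1 a2 : ℝ} (h1 : a1 ≤ 0) (h2 : a2 ≤ 0)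
    (hd : DifferentiableOn ℂ φ UnitBidisc) (hM : ∀ p ∈ UnitBidisc, ‖φ p‖ ≤ M) :
    MemM a1 a2 a1 a2 φ := by
  obtain ⟨b, hb⟩ := exists_isCoeff hd hM
  rintro f ⟨a, hfa, ha⟩
  exact ⟨coeffMul b a, hb.mul hfa, summable_wt_coeffMul h1 h2 hb hM ha⟩

lemma summable_add_one_rpow_mul_geometric (s : ℝ) {r : ℝ} (hr0 : 0 ≤ r) (hr1 : r < 1) :
    Summable fun k : ℕ => ((k : ℝ) + 1) ^ s * r ^ k := by
  obtain ⟨ρ, hρ, hρ1⟩ := exists_between hr1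
  have hρ0 : 0 < ρ := hr0.trans_lt hρ
  obtain ⟨m, hm⟩ := exists_nat_ge s
  have h := (summable_nat_add_iff 1).2 (summable_pow_mul_geometric_of_norm_lt_one m
    (r := ρ) (by rwa [Real.norm_of_nonneg hρ0.le]))
  refine .of_nonneg_of_le (fun k => by positivity) (fun k => ?_) (h.mul_left ρ⁻¹)
  have h1 : ((k : ℝ) + 1) ^ s ≤ ((k : ℝ) + 1) ^ m := by
    rw [← Real.rpow_natCast]
    exact Real.rpow_le_rpow_of_exponent_le (by linarith [(Nat.cast_nonneg k : (0 : ℝ) ≤ k)]) hm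
  have h2 : r ^ k ≤ ρ ^ k := pow_le_pow_left₀ hr0 hρ.le k
  calc ((k : ℝ) + 1) ^ s * r ^ k ≤ ((k : ℝ) + 1) ^ m * ρ ^ k := by gcongr
    _ = ρ⁻¹ * (((k + 1 : ℕ) : ℝ) ^ m * ρ ^ (k + 1)) := by
      push_cast
      rw [pow_succ]
      field_simp

/-- The sum of a double power series is holomorphic. -/
lemma IsCoeff.differentiableOn {f : ℂ × ℂ → ℂ} {a : ℕ → ℕ → ℂ} (hf : IsCoeff f a) :
    DifferentiableOn ℂ f UnitBidisc := by
  intro p hp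
  obtain ⟨r, hpr, hr1⟩ := exists_between (max_lt hp.1 hp.2)
  have hr0 : 0 < r := (le_max_of_le_left (norm_nonneg _)).trans_lt hpr
  obtain ⟨ρ, hrρ, hρ1⟩ := exists_between hr1
  have hρ0 : 0 < ρ := hr0.trans hrρ
  have hsub : ball (0 : ℂ × ℂ) r ⊆ UnitBidisc := by
    intro q hq
    rw [mem_ball_zero_iff, Prod.norm_def, max_lt_iff] at hq
    exact ⟨hq.1.trans hr1, hq.2.trans hr1⟩
  have hpball : p ∈ ball (0 : ℂ × ℂ) r := by rwa [mem_ball_zero_iff, Prod.norm_def]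
  obtain ⟨C, hC⟩ : ∃ C, ∀ n : ℕ × ℕ, ‖a n.1 n.2‖ * ρ ^ (n.1 + n.2) ≤ C :=
    ⟨_, fun n => (hf.summable_norm hρ0.le hρ1).le_tsum n fun m _ => by positivity⟩
  let F' : ℕ × ℕ → ℂ × ℂ → ℂ × ℂ →L[ℂ] ℂ := fun n q =>
    (a n.1 n.2 * (n.1 * q.1 ^ (n.1 - 1)) * q.2 ^ n.2) • ContinuousLinearMap.fst ℂ ℂ ℂ +
      (a n.1 n.2 * q.1 ^ n.1 * (n.2 * q.2 ^ (n.2 - 1))) • ContinuousLinearMap.snd ℂ ℂ ℂ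
  have hsum1 := summable_add_one_rpow_mul_geometric 1 (r := r / ρ) (by positivity)
    ((div_lt_one hρ0).2 hrρ)
  simp only [Real.rpow_one] at hsum1
  have hu : Summable fun n : ℕ × ℕ => 2 * C / r *
      ((((n.1 : ℝ) + 1) * (r / ρ) ^ n.1) * (((n.2 : ℝ) + 1) * (r / ρ) ^ n.2)) :=
    (hsum1.mul_of_nonneg hsum1 (fun _ => by positivity) fun _ => by positivity).mul_left _
  have hderiv : HasFDerivAt (fun q : ℂ × ℂ => ∑' n : ℕ × ℕ, a n.1 n.2 * q.1 ^ n.1 * q.2 ^ n.2)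
      (∑' n, F' n p) p := by
    refine hasFDerivAt_tsum_of_isPreconnected hu isOpen_ball
      (convex_ball (0 : ℂ × ℂ) r).isPreconnected (fun n q _ => ?_) (fun n q hq => ?_)
      hpball (hf p hp).summable hpball
    · have h1 : HasFDerivAt (fun q : ℂ × ℂ => q.1 ^ n.1)
          (((n.1 : ℂ) * q.1 ^ (n.1 - 1)) • ContinuousLinearMap.fst ℂ ℂ ℂ) q :=
        (hasDerivAt_pow n.1 q.1).comp_hasFDerivAt q hasFDerivAt_fst
      have h2 : HasFDerivAt (fun q : ℂ × ℂ => q.2 ^ n.2)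
          (((n.2 : ℂ) * q.2 ^ (n.2 - 1)) • ContinuousLinearMap.snd ℂ ℂ ℂ) q :=
        (hasDerivAt_pow n.2 q.2).comp_hasFDerivAt q hasFDerivAt_snd
      convert! (h1.const_mul (a n.1 n.2)).mul h2 using 1
      ext
      · simp [F']
        ring
      · simp [F']
    · rw [mem_ball_zero_iff, Prod.norm_def, max_lt_iff] at hq
      have hpow : ∀ (k : ℕ) (z : ℂ), ‖z‖ < r → ‖(k : ℂ) * z ^ (k - 1)‖ ≤ r⁻¹ * ((k + 1) * r ^ k) := by
        intro k z hz
        rw [norm_mul, norm_pow, Complex.norm_natCast]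
        rcases k with _ | k
        · simp [hr0.le]
        · have : ‖z‖ ^ k ≤ r ^ k := pow_le_pow_left₀ (norm_nonneg _) hz.le k
          have h3 : r⁻¹ * (((k + 1 : ℕ) + 1 : ℝ) * r ^ (k + 1)) = ((k + 1 : ℕ) + 1 : ℝ) * r ^ k := by
            rw [pow_succ]
            field_simp
          rw [h3, Nat.add_sub_cancel]
          gcongr
          linarith
      have hpow' : ∀ (k : ℕ) (z : ℂ), ‖z‖ < r → ‖z ^ k‖ ≤ (k + 1) * r ^ k := by
        intro k z hz
        rw [norm_pow]
        have h3 : ‖z‖ ^ k ≤ r ^ k := pow_le_pow_left₀ (norm_nonneg _) hz.le k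
        nlinarith [pow_pos hr0 k, (Nat.cast_nonneg k : (0 : ℝ) ≤ k)]
      set A := ‖a n.1 n.2‖
      set X := ((n.1 : ℝ) + 1) * r ^ n.1
      set Y := ((n.2 : ℝ) + 1) * r ^ n.2
      have hA : A * (X * Y) ≤ C * ((((n.1 : ℝ) + 1) * (r / ρ) ^ n.1) *
          (((n.2 : ℝ) + 1) * (r / ρ) ^ n.2)) := by
        have h4 : A * (X * Y) = (A * ρ ^ (n.1 + n.2)) * ((((n.1 : ℝ) + 1) * (r / ρ) ^ n.1) *
            (((n.2 : ℝ) + 1) * (r / ρ) ^ n.2)) := by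
          simp only [X, Y, div_pow, pow_add]
          field_simp
        rw [h4]
        exact mul_le_mul_of_nonneg_right (hC n) (by positivity)
      have hfst : ‖(a n.1 n.2 * (n.1 * q.1 ^ (n.1 - 1)) * q.2 ^ n.2) •
          ContinuousLinearMap.fst ℂ ℂ ℂ‖ ≤ A * (r⁻¹ * X) * Y := by
        rw [norm_smul, norm_mul, norm_mul]
        refine (mul_le_of_le_one_right (by positivity)
          (ContinuousLinearMap.norm_fst_le ℂ ℂ ℂ)).trans ?_
        gcongr
        · exact hpow _ _ hq.1
        · exact hpow' _ _ hq.2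
      have hsnd : ‖(a n.1 n.2 * q.1 ^ n.1 * (n.2 * q.2 ^ (n.2 - 1))) •
          ContinuousLinearMap.snd ℂ ℂ ℂ‖ ≤ A * X * (r⁻¹ * Y) := by
        rw [norm_smul, norm_mul, norm_mul]
        refine (mul_le_of_le_one_right (by positivity)
          (ContinuousLinearMap.norm_snd_le ℂ ℂ ℂ)).trans ?_
        gcongr
        · exact hpow' _ _ hq.1
        · exact hpow _ _ hq.2
      calc ‖F' n q‖ ≤ A * (r⁻¹ * X) * Y + A * X * (r⁻¹ * Y) :=
            (norm_add_le _ _).trans (add_le_add hfst hsnd)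
        _ = 2 / r * (A * (X * Y)) := by ring
        _ ≤ 2 / r * (C * ((((n.1 : ℝ) + 1) * (r / ρ) ^ n.1) *
            (((n.2 : ℝ) + 1) * (r / ρ) ^ n.2))) := by gcongr
        _ = _ := by ring
  have heq : f =ᶠ[𝓝 p] fun q => ∑' n : ℕ × ℕ, a n.1 n.2 * q.1 ^ n.1 * q.2 ^ n.2 := by
    filter_upwards [isOpen_ball.mem_nhds hpball] with q hq using (hf q (hsub hq)).tsum_eq.symm
  exact (hderiv.congr_of_eventuallyEq heq).differentiableAt.differentiableWithinAt

lemma memD_one (a1 a2 : ℝ) : MemD a1 a2 fun _ => 1 := by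
  refine ⟨fun k l => if (k, l) = (0, 0) then 1 else 0, fun p _ => ?_, ?_⟩
  · refine Eq.mp (congrArg (HasSum · 1) (funext fun n => ?_)) (hasSum_ite_eq ((0, 0) : ℕ × ℕ) (1 : ℂ))
    split_ifs with hn <;> simp [hn]
  · refine summable_of_ne_finset_zero (s := {(0, 0)}) fun n hn => ?_
    rw [Finset.mem_singleton] at hn
    simp [wt, if_neg hn]

/-- The square root of the weight defining the Dirichlet type space. -/
noncomputable def sqrtWeight (a1 a2 : ℝ) (n : ℕ × ℕ) : ℝ :=
  √(((n.1 : ℝ) + 1) ^ a1 * ((n.2 : ℝ) + 1) ^ a2)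

lemma sqrtWeight_pos (a1 a2 : ℝ) (n : ℕ × ℕ) : 0 < sqrtWeight a1 a2 n := by
  unfold sqrtWeight
  positivity

lemma wt_eq_sq (a1 a2 : ℝ) (a : ℕ → ℕ → ℂ) (n : ℕ × ℕ) :
    wt a1 a2 a n = ‖a n.1 n.2 * (sqrtWeight a1 a2 n : ℂ)‖ ^ 2 := by
  rw [norm_mul, mul_pow, Complex.norm_real, Real.norm_of_nonneg (sqrtWeight_pos _ _ _).le,
    sqrtWeight, Real.sq_sqrt (by positivity), wt, mul_assoc]

lemma memℓp_two_iff {ι : Type*} {c : ι → ℂ} : Memℓp c 2 ↔ Summable fun i => ‖c i‖ ^ 2 := by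
  rw [memℓp_gen_iff (by norm_num)]
  norm_num

/-- The reproducing kernel at a point of the bidisc is square-summable. -/
lemma memℓp_kernel (a1 a2 : ℝ) {p : ℂ × ℂ} (hp : p ∈ UnitBidisc) :
    Memℓp (fun n : ℕ × ℕ =>
      (starRingEnd ℂ) (p.1 ^ n.1 * p.2 ^ n.2 * ((sqrtWeight a1 a2 n : ℂ))⁻¹)) 2 := by
  rw [memℓp_two_iff]
  have hs : ∀ (s : ℝ) (z : ℂ), ‖z‖ < 1 → Summable fun k : ℕ => ((k : ℝ) + 1) ^ s * (‖z‖ ^ 2) ^ k :=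
    fun s z hz => summable_add_one_rpow_mul_geometric s (by positivity) (by
      nlinarith [norm_nonneg z])
  refine ((hs (-a1) p.1 hp.1).mul_of_nonneg (hs (-a2) p.2 hp.2) (fun _ => by positivity)
    fun _ => by positivity).congr fun n => ?_
  rw [RCLike.norm_conj, norm_mul, norm_mul, norm_inv, norm_pow, norm_pow, Complex.norm_real,
    Real.norm_of_nonneg (sqrtWeight_pos _ _ _).le, mul_pow, inv_pow, sqrtWeight,
    Real.sq_sqrt (by positivity), Real.rpow_neg (by positivity), Real.rpow_neg (by positivity)]
  ring

/-- Multipliers are bounded. -/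
lemma MemM.bounded {φ : ℂ × ℂ → ℂ} {a1 a2 : ℝ} (hφ : MemM a1 a2 a1 a2 φ) :
    ∃ M : ℝ, ∀ p ∈ UnitBidisc, ‖φ p‖ ≤ M := by
  let κ : UnitBidisc → lp (fun _ : ℕ × ℕ => ℂ) 2 := fun p => ⟨_, memℓp_kernel a1 a2 p.2⟩
  have hκ : ∀ p, ‖κ p‖ ≠ 0 := by
    intro p h
    have h0 : (κ p) (0, 0) = 0 := by rw [norm_eq_zero.1 h]; rfl
    have h1 : (κ p) (0, 0) = 1 := by simp [κ, sqrtWeight]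
    exact one_ne_zero (h1.symm.trans h0)
  have hinner : ∀ (p : UnitBidisc) (c : lp (fun _ : ℕ × ℕ => ℂ) 2),
      HasSum (fun n : ℕ × ℕ => c n * ((sqrtWeight a1 a2 n : ℂ))⁻¹ * p.1.1 ^ n.1 * p.1.2 ^ n.2)
        (inner ℂ (κ p) c) := by
    intro p c
    refine Eq.mp (congrArg (HasSum · _) (funext fun n => ?_)) (lp.hasSum_inner (κ p) c)
    simp only [κ, RCLike.inner_apply, Complex.conj_conj]
    ring
  have hpt : ∀ c : lp (fun _ : ℕ × ℕ => ℂ) 2, ∃ C, ∀ p : UnitBidisc,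
      ‖((φ p.1 / ‖κ p‖ : ℂ) • innerSL ℂ (κ p)) c‖ ≤ C := by
    intro c
    have hw : ∀ n, (sqrtWeight a1 a2 n : ℂ) ≠ 0 := fun n => by
      exact_mod_cast (sqrtWeight_pos a1 a2 n).ne'
    obtain ⟨f, hf⟩ : ∃ f : ℂ × ℂ → ℂ, ∀ p : UnitBidisc, f p.1 = inner ℂ (κ p) c := by
      classical
      exact ⟨fun p => if h : p ∈ UnitBidisc then inner ℂ (κ ⟨p, h⟩) c else 0, fun p => dif_pos p.2⟩
    obtain ⟨a, ha, hsa⟩ := hφ f ⟨fun k l => c (k, l) * ((sqrtWeight a1 a2 (k, l) : ℂ))⁻¹,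
      fun p hp => by simpa only [hf ⟨p, hp⟩] using hinner ⟨p, hp⟩ c, by
        refine (memℓp_two_iff.1 (lp.memℓp c)).congr fun n => ?_
        rw [wt_eq_sq, inv_mul_cancel_right₀ (hw n)]⟩
    let c' : lp (fun _ : ℕ × ℕ => ℂ) 2 := ⟨fun n => a n.1 n.2 * (sqrtWeight a1 a2 n : ℂ),
      memℓp_two_iff.2 (hsa.congr fun n => wt_eq_sq a1 a2 a n)⟩
    refine ⟨‖c'‖, fun p => ?_⟩
    have h1 : inner ℂ (κ p) c' = φ p.1 * inner ℂ (κ p) c := by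
      rw [← hf p]
      refine (hinner p c').unique ?_
      convert! ha p.1 p.2 using 2 with n
      simp only [c', mul_inv_cancel_right₀ (hw n)]
    have h2 : ((φ p.1 / ‖κ p‖ : ℂ) • innerSL ℂ (κ p)) c = inner ℂ (κ p) c' / ‖κ p‖ := by
      rw [h1, smul_apply, innerSL_apply_apply, smul_eq_mul]
      ring
    rw [h2, norm_div, Complex.norm_real, norm_norm,
      div_le_iff₀ (lt_of_le_of_ne (norm_nonneg _) (hκ p).symm), mul_comm]
    exact norm_inner_le_norm _ _
  obtain ⟨M, hM⟩ := banach_steinhaus hpt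
  refine ⟨M, fun p hp => ?_⟩
  have h := hM ⟨p, hp⟩
  rwa [norm_smul, innerSL_apply_norm, norm_div, Complex.norm_real, norm_norm,
    div_mul_cancel₀ _ (hκ _)] at h

/-- for `α ⪯ (0,0)`, `M(D_α) = H^∞(𝕌²)`. -/
theorem stmt11 (a1 a2 : ℝ) (h1 : a1 ≤ 0) (h2 : a2 ≤ 0) :
    {φ : ℂ × ℂ → ℂ | MemM a1 a2 a1 a2 φ} =
      {φ : ℂ × ℂ → ℂ | DifferentiableOn ℂ φ UnitBidisc ∧
        ∃ M : ℝ, ∀ p ∈ UnitBidisc, ‖φ p‖ ≤ M} := by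
  ext φ
  constructor
  · intro hφ
    obtain ⟨b, hb, -⟩ := hφ _ (memD_one a1 a2)
    simp only [mul_one] at hb
    exact ⟨hb.differentiableOn, hφ.bounded⟩
  · rintro ⟨hd, M, hM⟩
    exact memM_of_bounded h1 h2 hd hM
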